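/- Let Y be a random variable on Ω satisfying both distributional consistency and ignorability. Then Y ⊥ F_T | T: for every t ∈ {0,1}, every regime r ∈ {0, 1, e} with μ_r(T = t) > 0, and every measurable set A, μ_r(Y ∈ A | T = t) = μ_t(Y ∈ A); in particular, if μ_e(T = t) > 0 then μ_e(Y ∈ A | T = t) = μ_t(Y ∈ A). (Lemma 2.) -/

import Mathlib

open MeasureTheory ProbabilityTheory

/-- Conditioning on almost everywhere equal sets gives the same measure. -/
theorem cond_congr_set_ae {Ω : Type*} [MeasurableSpace Ω] {μ : Measure Ω} {s t : Set Ω}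
    (h : s =ᵐ[μ] t) : μ[|s] = μ[|t] := by
  simp only [ProbabilityTheory.cond, measure_congr h, Measure.restrict_congr_set h]

/-- Conditioning a probability measure on the value of an almost surely constant map
does nothing, as soon as that value has positive probability. -/
theorem cond_fiber_of_ae_eq_const {Ω α : Type*} [MeasurableSpace Ω] {μ : Measure Ω}
    [IsProbabilityMeasure μ] {X : Ω → α} {c x : α} (hX : ∀ᵐ ω ∂μ, X ω = c)
    (hx : 0 < μ {ω | X ω = x}) : x = c ∧ μ[|{ω | X ω = x}] = μ := by
  have hxc : x = c := by
    by_contra hne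
    refine hx.ne' (measure_mono_null ?_ (ae_iff.mp hX))
    rintro ω rfl
    exact hne
  subst hxc
  exact ⟨rfl, (cond_congr_set_ae (Filter.eventuallyEq_univ.mpr hX)).trans (cond_univ μ)⟩

/-- **Lemma 2.** In a three-regime treatment model, if `Y` satisfies
distributional consistency and ignorability, then `Y ⫫ F_T | T`: for every regime `r` and
`t` with positive probability of `T = t`, the conditional distribution of `Y` given `T = t`
under regime `r` equals the (marginal) distribution of `Y` under the interventional
regime `μ_t`. -/
theorem dt_ignorability_implies_Y_indep_regime_given_T
    {Ω : Type*} [MeasurableSpace Ω] {β : Type*} [MeasurableSpace β]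
    (μ0 μ1 μe : Measure Ω)
    [IsProbabilityMeasure μ0] [IsProbabilityMeasure μ1] [IsProbabilityMeasure μe]
    (T Tstar : Ω → Bool) (hT : Measurable T) (hTstar : Measurable Tstar)
    (hT0 : ∀ᵐ ω ∂μ0, T ω = false)
    (hT1 : ∀ᵐ ω ∂μ1, T ω = true)
    (hTe : ∀ᵐ ω ∂μe, T ω = Tstar ω)
    (hTstarDist : ∀ t : Bool,
      μ0 {ω | Tstar ω = t} = μe {ω | Tstar ω = t} ∧
      μ1 {ω | Tstar ω = t} = μe {ω | Tstar ω = t})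
    (Y : Ω → β) (hY : Measurable Y)
    (hDC : ∀ t : Bool, 0 < μe {ω | Tstar ω = t} →
      ∀ A : Set β, MeasurableSet A →
        μe[|{ω | Tstar ω = t}] {ω | Y ω ∈ A} =
          (bif t then μ1 else μ0)[|{ω | Tstar ω = t}] {ω | Y ω ∈ A})
    (hIgn : ∀ t tstar : Bool, 0 < (bif t then μ1 else μ0) {ω | Tstar ω = tstar} →
      ∀ A : Set β, MeasurableSet A →
        (bif t then μ1 else μ0)[|{ω | Tstar ω = tstar}] {ω | Y ω ∈ A} =
          (bif t then μ1 else μ0) {ω | Y ω ∈ A}) :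
    ∀ t : Bool, ∀ μr ∈ ({μ0, μ1, μe} : Set (Measure Ω)),
      0 < μr {ω | T ω = t} →
      ∀ A : Set β, MeasurableSet A →
        μr[|{ω | T ω = t}] {ω | Y ω ∈ A} = (bif t then μ1 else μ0) {ω | Y ω ∈ A} := by
  intro t μr hμr hpos A hA
  obtain rfl | rfl | rfl := hμr
  · obtain ⟨rfl, h⟩ := cond_fiber_of_ae_eq_const hT0 hpos
    rw [h]; rfl
  · obtain ⟨rfl, h⟩ := cond_fiber_of_ae_eq_const hT1 hpos
    rw [h]; rfl
  · have hset : {ω | T ω = t} =ᵐ[μr] {ω | Tstar ω = t} := by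
      filter_upwards [hTe] with ω hω
      exact congrArg (· = t) hω
    rw [measure_congr hset] at hpos
    rw [cond_congr_set_ae hset, hDC t hpos A hA]
    refine hIgn t t ?_ A hA
    cases t
    · exact (hTstarDist false).1 ▸ hpos
    · exact (hTstarDist true).2 ▸ hpos
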